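/- Clifford Twirl: Let n : ℕ and let G be a finite subgroup of the unitary group Matrix.unitaryGroup (Fin n → Fin 2) ℂ such that (i) every n-qubit Pauli tensor P_s (for s : Fin n → Fin 4) belongs to G, and (ii) for every C ∈ G and every label s : Fin n → Fin 4 there exist a label s' : Fin n → Fin 4 and a scalar α ∈ ({1, -1, Complex.I, -Complex.I} : Set ℂ) with Cᴴ * P_s * C = α • P_{s'}. Then for all distinct labels s ≠ s' : Fin n → Fin 4 and every matrix ρ : Matrix (Fin n → Fin 2) (Fin n → Fin 2) ℂ, the sum over all C ∈ G of (Cᴴ * P_s * C) * ρ * (Cᴴ * P_{s'} * C) equals the zero matrix. -/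

import Mathlib

open Matrix

/-- Single-qubit Pauli matrices indexed by `Fin 4`: I, X, Y, Z. -/
def pauli : Fin 4 → Matrix (Fin 2) (Fin 2) ℂ
  | 0 => !![1, 0; 0, 1]
  | 1 => !![0, 1; 1, 0]
  | 2 => !![0, -Complex.I; Complex.I, 0]
  | 3 => !![1, 0; 0, -1]

/-- The `n`-qubit Pauli tensor indexed by a label `s : Fin n → Fin 4`. -/
def pauliTensor {n : ℕ} (s : Fin n → Fin 4) :
    Matrix (Fin n → Fin 2) (Fin n → Fin 2) ℂ :=
  Matrix.of fun f g => ∏ k, pauli (s k) (f k) (g k)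

/-- The sign by which conjugation with the Pauli matrix `a` multiplies the Pauli matrix `b`. -/
def pauliSign (a b : Fin 4) : ℂ := if a = 0 ∨ b = 0 ∨ a = b then 1 else -1

lemma pauliSign_zero_left (b : Fin 4) : pauliSign 0 b = 1 := by
  simp [pauliSign]

lemma pauli_conjTranspose_mul_mul (a b : Fin 4) :
    (pauli a)ᴴ * pauli b * pauli a = pauliSign a b • pauli b := by
  fin_cases a <;> fin_cases b <;> ext i j <;> fin_cases i <;> fin_cases j <;>
    simp [pauli, pauliSign, Matrix.mul_apply, Fin.sum_univ_two]

lemma exists_pauliSign_mul_eq_neg_one {a b : Fin 4} (hab : a ≠ b) :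
    ∃ c, pauliSign c a * pauliSign c b = -1 := by
  have key : ∀ a b : Fin 4, a ≠ b → ∃ c : Fin 4,
      ((c = 0 ∨ a = 0 ∨ c = a) ∧ ¬(c = 0 ∨ b = 0 ∨ c = b)) ∨
      (¬(c = 0 ∨ a = 0 ∨ c = a) ∧ (c = 0 ∨ b = 0 ∨ c = b)) := by decide
  obtain ⟨c, ⟨h₁, h₂⟩ | ⟨h₁, h₂⟩⟩ := key a b hab
  all_goals
    refine ⟨c, ?_⟩
    rw [pauliSign, pauliSign]
    simp only [h₁, h₂, if_true, if_false]
    norm_num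

lemma of_prod_mul_of_prod {ι κ R : Type*} [Fintype ι] [DecidableEq ι] [Fintype κ]
    [CommSemiring R] (A B : ι → Matrix κ κ R) :
    (Matrix.of fun f g : ι → κ => ∏ k, A k (f k) (g k)) *
        (Matrix.of fun f g : ι → κ => ∏ k, B k (f k) (g k)) =
      Matrix.of fun f g : ι → κ => ∏ k, (A k * B k) (f k) (g k) := by
  ext f g
  simp only [Matrix.mul_apply, Matrix.of_apply, ← Finset.prod_mul_distrib]
  rw [Finset.prod_univ_sum, Fintype.piFinset_univ]

lemma pauliTensor_conjTranspose_mul_mul {n : ℕ} (v s : Fin n → Fin 4) :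
    (pauliTensor v)ᴴ * pauliTensor s * pauliTensor v =
      (∏ k, pauliSign (v k) (s k)) • pauliTensor s := by
  have h : (pauliTensor v)ᴴ =
      Matrix.of fun f g : Fin n → Fin 2 => ∏ k, (pauli (v k))ᴴ (f k) (g k) := by
    ext f g
    simp [pauliTensor, Matrix.conjTranspose_apply]
  rw [h, pauliTensor, pauliTensor, of_prod_mul_of_prod, of_prod_mul_of_prod]
  ext f g
  simp [pauli_conjTranspose_mul_mul, Finset.prod_mul_distrib]

lemma exists_prod_pauliSign_mul_eq_neg_one {n : ℕ} {s s' : Fin n → Fin 4} (hss : s ≠ s') :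
    ∃ v : Fin n → Fin 4,
      (∏ k, pauliSign (v k) (s k)) * (∏ k, pauliSign (v k) (s' k)) = -1 := by
  obtain ⟨i, hi⟩ := Function.ne_iff.mp hss
  obtain ⟨c, hc⟩ := exists_pauliSign_mul_eq_neg_one hi
  have h (t : Fin n → Fin 4) :
      ∏ k, pauliSign ((Pi.single i c : Fin n → Fin 4) k) (t k) = pauliSign c (t i) := by
    rw [Finset.prod_eq_single_of_mem i (Finset.mem_univ i), Pi.single_eq_same]
    intro k _ hk
    rw [Pi.single_eq_of_ne hk, pauliSign_zero_left]
  exact ⟨Pi.single i c, by rw [h, h, hc]⟩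

/-- Clifford twirl: for a finite subgroup of the unitary group containing all Pauli
tensors and mapping Pauli tensors to Pauli tensors up to phase under conjugation,
the twirl of two distinct Paulis vanishes. -/
theorem clifford_twirl (n : ℕ)
    (G : Subgroup (Matrix.unitaryGroup (Fin n → Fin 2) ℂ)) [Fintype G]
    (hPauli : ∀ s : Fin n → Fin 4, ∃ U : Matrix.unitaryGroup (Fin n → Fin 2) ℂ,
      U ∈ G ∧ (U : Matrix (Fin n → Fin 2) (Fin n → Fin 2) ℂ) = pauliTensor s)
    (hCliff : ∀ C : Matrix.unitaryGroup (Fin n → Fin 2) ℂ, C ∈ G →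
      ∀ s : Fin n → Fin 4, ∃ s' : Fin n → Fin 4,
        ∃ α ∈ ({1, -1, Complex.I, -Complex.I} : Set ℂ),
          (C : Matrix (Fin n → Fin 2) (Fin n → Fin 2) ℂ)ᴴ * pauliTensor s * C =
            α • pauliTensor s')
    (s s' : Fin n → Fin 4) (hss : s ≠ s')
    (ρ : Matrix (Fin n → Fin 2) (Fin n → Fin 2) ℂ) :
    ∑ C : G,
      (((C : Matrix.unitaryGroup (Fin n → Fin 2) ℂ) :
          Matrix (Fin n → Fin 2) (Fin n → Fin 2) ℂ)ᴴ * pauliTensor s *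
        ((C : Matrix.unitaryGroup (Fin n → Fin 2) ℂ) :
          Matrix (Fin n → Fin 2) (Fin n → Fin 2) ℂ)) * ρ *
      (((C : Matrix.unitaryGroup (Fin n → Fin 2) ℂ) :
          Matrix (Fin n → Fin 2) (Fin n → Fin 2) ℂ)ᴴ * pauliTensor s' *
        ((C : Matrix.unitaryGroup (Fin n → Fin 2) ℂ) :
          Matrix (Fin n → Fin 2) (Fin n → Fin 2) ℂ)) = 0 := by
  obtain ⟨v, hv⟩ := exists_prod_pauliSign_mul_eq_neg_one hss
  obtain ⟨U, hU, hUv⟩ := hPauli v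
  have conj (M : Matrix (Fin n → Fin 2) (Fin n → Fin 2) ℂ) (t : Fin n → Fin 4) :
      (pauliTensor v * M)ᴴ * pauliTensor t * (pauliTensor v * M) =
        (∏ k, pauliSign (v k) (t k)) • (Mᴴ * pauliTensor t * M) := by
    rw [← Matrix.smul_mul, ← Matrix.mul_smul, ← pauliTensor_conjTranspose_mul_mul,
      Matrix.conjTranspose_mul]
    simp only [Matrix.mul_assoc]
  refine Matrix.ext fun f g => self_eq_neg.mp ?_
  rw [← Matrix.neg_apply]
  refine congrFun (congrFun (?_ : (_ : Matrix _ _ ℂ) = _) f) g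
  conv_lhs => rw [← Equiv.sum_comp (Equiv.mulLeft (⟨U, hU⟩ : G))]
  rw [← Finset.sum_neg_distrib]
  refine Finset.sum_congr rfl fun C _ => ?_
  simp only [Equiv.coe_mulLeft, Subgroup.coe_mul, Submonoid.coe_mul, hUv, conj]
  rw [Matrix.smul_mul, Matrix.smul_mul, Matrix.mul_smul, smul_smul, hv, neg_one_smul]
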